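/- Corollary (privacy of random projection of a well-conditioned matrix): Let n, d be positive integers, ε, δ ∈ (0,1), let r be a positive integer, and set w = (16·√(r·ln(2/δ))/ε)·ln(16r/δ); assume w ≥ 2. Let A, A′ be neighboring n×d real matrices such that ‖Ax‖₂ ≥ w‖x‖₂ and ‖A′x‖₂ ≥ w‖x‖₂ for every x ∈ ℝ^d (all singular values of A and A′ are at least w). Let μ_A be the pushforward of the standard Gaussian measure γ_{r×n} on r×n matrices under M ↦ M·A, and similarly μ_{A′}. Then for every measurable set S of r×d real matrices, μ_A(S) ≤ e^ε·μ_{A′}(S) + δ. -/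

import Mathlib

open MeasureTheory ProbabilityTheory Matrix

noncomputable section

instance matMeas (m n : Type*) : MeasurableSpace (Matrix m n ℝ) :=
  inferInstanceAs (MeasurableSpace (m → n → ℝ))

/-- The standard Gaussian measure on `ι → ℝ`: iid standard normal coordinates. -/
def stdGaussianPi (ι : Type*) [Fintype ι] : Measure (ι → ℝ) :=
  Measure.pi fun _ => gaussianReal 0 1

instance (ι : Type*) [Fintype ι] : IsProbabilityMeasure (stdGaussianPi ι) := by
  unfold stdGaussianPi; infer_instance

/-- The measure on `m × ι` real matrices with iid standard normal entries. -/
def stdGaussianMatrix (m ι : Type*) [Fintype m] [Fintype ι] : Measure (Matrix m ι ℝ) :=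
  (Measure.pi fun _ : m => stdGaussianPi ι : Measure (m → ι → ℝ))

/-- Two `n×d` matrices are neighbors if they differ on a single row,
whose change has `ℓ₂`-norm at most 1. -/
def MatNeighbors {n d : ℕ} (A A' : Matrix (Fin n) (Fin d) ℝ) : Prop :=
  ∃ (i : Fin n) (v : Fin d → ℝ), Real.sqrt (∑ j, v j ^ 2) ≤ 1 ∧
    A' = A + Matrix.of fun k j => if k = i then v j else 0

/-- Mean-centering of the rows of `A`:  `A - (1/n)·J·A` with `J` the all-ones matrix. -/
def centerMat {n d : ℕ} (A : Matrix (Fin n) (Fin d) ℝ) : Matrix (Fin n) (Fin d) ℝ :=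
  A - ((n : ℝ)⁻¹) • ((Matrix.of fun _ _ : Fin n => (1 : ℝ)) * A)

/-- Tonelli for a product of functions of the individual coordinates. -/
lemma lintegral_pi_prod {X : Type*} [MeasurableSpace X] (μ : Measure X) [SigmaFinite μ] :
    ∀ (n : ℕ) (f : Fin n → X → ENNReal), (∀ i, Measurable (f i)) →
      ∫⁻ x, ∏ i, f i (x i) ∂(Measure.pi fun _ : Fin n => μ) = ∏ i, ∫⁻ x, f i x ∂μ := by
  intro n
  induction n with
  | zero => intro f _; simp
  | succ n ih =>
    intro f hf
    rw [← ((measurePreserving_piFinSuccAbove (fun _ : Fin (n + 1) => μ) 0).symm).lintegral_comp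
      (by fun_prop)]
    simp only [Fin.prod_univ_succ, MeasurableEquiv.piFinSuccAbove, MeasurableEquiv.symm_mk,
      MeasurableEquiv.coe_mk, Fin.insertNthEquiv, Equiv.symm_symm, Equiv.coe_fn_mk,
      Fin.insertNth_zero', Fin.cons_zero, Fin.cons_succ]
    rw [lintegral_prod_mul (f := f 0)
      (g := fun y : Fin n → X => ∏ i, f (Fin.succ i) (y i)) (hf 0).aemeasurable
      (Finset.measurable_prod _ fun i _ => (hf i.succ).comp (measurable_pi_apply i)).aemeasurable]
    congr 1
    exact ih _ fun i => hf _

lemma pi_withDensity {X : Type*} [MeasurableSpace X] (μ : Measure X) [SigmaFinite μ] (n : ℕ)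
    {f : X → ENNReal} (hf : Measurable f) [SigmaFinite (μ.withDensity f)] :
    Measure.pi (fun _ : Fin n => μ.withDensity f)
      = (Measure.pi fun _ : Fin n => μ).withDensity fun x => ∏ i, f (x i) := by
  refine Measure.pi_eq fun s hs => ?_
  rw [withDensity_apply _ (.univ_pi hs), ← lintegral_indicator (.univ_pi hs)]
  have h : (Set.univ.pi s).indicator (fun x : Fin n → X => ∏ i, f (x i))
      = fun x => ∏ i, (s i).indicator f (x i) := by
    ext x
    by_cases hx : x ∈ Set.univ.pi s
    · rw [Set.indicator_of_mem hx]
      exact Finset.prod_congr rfl fun i _ => (Set.indicator_of_mem (hx i trivial) f).symm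
    · rw [Set.indicator_of_notMem hx]
      simp only [Set.mem_univ_pi, not_forall] at hx
      obtain ⟨i, hi⟩ := hx
      exact (Finset.prod_eq_zero (Finset.mem_univ i) (Set.indicator_of_notMem hi f)).symm
  rw [h, lintegral_pi_prod μ n (fun i => (s i).indicator f) fun i => hf.indicator (hs i)]
  refine Finset.prod_congr rfl fun i _ => ?_
  rw [lintegral_indicator (hs i), withDensity_apply _ (hs i)]

/-- Independent copies of a reweighted transport. -/
lemma pi_apply_eq_setLIntegral_exp_neg_sum {X : Type*} [MeasurableSpace X] (μ : Measure X)
    [IsProbabilityMeasure μ] {Ψ : X → X} (hΨ : Measurable Ψ) {ℓ : X → ℝ} (hℓ : Measurable ℓ)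
    (hmap : (μ.withDensity fun x => ENNReal.ofReal (Real.exp (-ℓ x))).map Ψ = μ)
    (r : ℕ) {S : Set (Fin r → X)} (hS : MeasurableSet S) :
    Measure.pi (fun _ : Fin r => μ) S = ∫⁻ x in (fun x k => Ψ (x k)) ⁻¹' S,
      ENNReal.ofReal (Real.exp (-∑ k, ℓ (x k))) ∂(Measure.pi fun _ : Fin r => μ) := by
  have hΨr : Measurable (fun (x : Fin r → X) k => Ψ (x k)) := by fun_prop
  have hσ' : ∀ _ : Fin r,
      SigmaFinite ((μ.withDensity fun x => ENNReal.ofReal (Real.exp (-ℓ x))).map Ψ) := by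
    intro _; rw [hmap]; infer_instance
  have h1 := Measure.pi_map_pi (hμ := hσ') (f := fun _ => Ψ)
    (μ := fun _ => μ.withDensity fun x => ENNReal.ofReal (Real.exp (-ℓ x)))
    fun _ => hΨ.aemeasurable
  have h2 := pi_withDensity μ r (f := fun x => ENNReal.ofReal (Real.exp (-ℓ x))) (by fun_prop)
  simp only [hmap] at h1
  have h3 : ∀ x : Fin r → X, ∏ k, ENNReal.ofReal (Real.exp (-ℓ (x k)))
      = ENNReal.ofReal (Real.exp (-∑ k, ℓ (x k))) := by
    intro x
    rw [← ENNReal.ofReal_prod_of_nonneg (fun _ _ => (Real.exp_pos _).le), ← Real.exp_sum,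
      Finset.sum_neg_distrib]
  simp only [h3] at h2
  calc _ = Measure.map (fun x k => Ψ (x k)) (Measure.pi fun _ : Fin r =>
        μ.withDensity fun x => ENNReal.ofReal (Real.exp (-ℓ x))) S := by rw [h1]
    _ = _ := by rw [Measure.map_apply hΨr hS, h2, withDensity_apply _ (hΨr hS)]

lemma ofReal_exp_neg_mul_cancel (a : ℝ) (x : ENNReal) :
    ENNReal.ofReal (Real.exp (-a)) * (ENNReal.ofReal (Real.exp a) * x) = x := by
  rw [← mul_assoc, ← ENNReal.ofReal_mul (Real.exp_pos _).le, ← Real.exp_add]; simp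

/-- Chernoff bound for a sum of independent copies. -/
lemma pi_lt_sum_le_exp {X : Type*} [MeasurableSpace X] (μ : Measure X)
    [IsProbabilityMeasure μ] {ℓ : X → ℝ} (hℓ : Measurable ℓ) {l K : ℝ} (ε : ℝ) (hl : 0 ≤ l)
    (hK : ∫⁻ x, ENNReal.ofReal (Real.exp (l * ℓ x)) ∂μ ≤ ENNReal.ofReal (Real.exp K)) (r : ℕ) :
    Measure.pi (fun _ : Fin r => μ) {x | ε < ∑ k, ℓ (x k)}
      ≤ ENNReal.ofReal (Real.exp (r * K - l * ε)) := by
  have h3 : ENNReal.ofReal (Real.exp (l * ε)) *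
      Measure.pi (fun _ : Fin r => μ) {x | ε < ∑ k, ℓ (x k)}
      ≤ ENNReal.ofReal (Real.exp (r * K)) := by
    calc _ ≤ ENNReal.ofReal (Real.exp (l * ε)) * Measure.pi (fun _ : Fin r => μ)
          {x | ENNReal.ofReal (Real.exp (l * ε))
            ≤ ENNReal.ofReal (Real.exp (l * ∑ k, ℓ (x k)))} := by
          refine mul_le_mul_right (measure_mono fun x hx => ?_) _
          exact ENNReal.ofReal_le_ofReal
            (Real.exp_le_exp.2 (mul_le_mul_of_nonneg_left (le_of_lt hx) hl))
      _ ≤ ∫⁻ x, ENNReal.ofReal (Real.exp (l * ∑ k, ℓ (x k)))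
            ∂(Measure.pi fun _ : Fin r => μ) :=
          mul_meas_ge_le_lintegral (by fun_prop) _
      _ = ∫⁻ x, ∏ k, ENNReal.ofReal (Real.exp (l * ℓ (x k)))
            ∂(Measure.pi fun _ : Fin r => μ) := by
          refine lintegral_congr fun x => ?_
          rw [← ENNReal.ofReal_prod_of_nonneg (fun _ _ => (Real.exp_pos _).le),
            ← Real.exp_sum, Finset.mul_sum]
      _ = ∏ _k : Fin r, ∫⁻ x, ENNReal.ofReal (Real.exp (l * ℓ x)) ∂μ :=
          lintegral_pi_prod μ r (fun _ x => ENNReal.ofReal (Real.exp (l * ℓ x)))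
            fun _ => by fun_prop
      _ ≤ ∏ _k : Fin r, ENNReal.ofReal (Real.exp K) := Finset.prod_le_prod' fun _ _ => hK
      _ = ENNReal.ofReal (Real.exp (r * K)) := by
          rw [Finset.prod_const, Finset.card_univ, Fintype.card_fin,
            ← ENNReal.ofReal_pow (Real.exp_pos _).le, ← Real.exp_nat_mul]
  rw [← ofReal_exp_neg_mul_cancel (l * ε) (Measure.pi _ _), sub_eq_neg_add, Real.exp_add,
    ENNReal.ofReal_mul (Real.exp_pos _).le]
  exact mul_le_mul_right h3 _

/-- If `Ψ` transports `exp (-ℓ) μ` to `μ`, then a bound on the exponential moment of the privacy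
loss `ℓ` gives an approximate domination of `r` independent copies of `μ.map Ψ` by `r` independent
copies of `μ`. -/
lemma pi_preimage_le_of_exp_moment {X : Type*} [MeasurableSpace X] (μ : Measure X)
    [IsProbabilityMeasure μ] {Ψ : X → X} (hΨ : Measurable Ψ) {ℓ : X → ℝ} (hℓ : Measurable ℓ)
    (hmap : (μ.withDensity fun x => ENNReal.ofReal (Real.exp (-ℓ x))).map Ψ = μ)
    {l K ε : ℝ} (hl : 0 ≤ l)
    (hK : ∫⁻ x, ENNReal.ofReal (Real.exp (l * ℓ x)) ∂μ ≤ ENNReal.ofReal (Real.exp K))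
    (r : ℕ) {S : Set (Fin r → X)} (hS : MeasurableSet S) :
    Measure.pi (fun _ : Fin r => μ) ((fun x k => Ψ (x k)) ⁻¹' S)
      ≤ ENNReal.ofReal (Real.exp ε) * Measure.pi (fun _ : Fin r => μ) S
        + ENNReal.ofReal (Real.exp (r * K - l * ε)) := by
  have hΨr : Measurable (fun (x : Fin r → X) k => Ψ (x k)) := by fun_prop
  have hm : MeasurableSet {x : Fin r → X | ∑ k, ℓ (x k) ≤ ε} :=
    measurableSet_le (by fun_prop) measurable_const
  have hgood : ENNReal.ofReal (Real.exp (-ε)) * Measure.pi (fun _ : Fin r => μ)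
      ((fun x k => Ψ (x k)) ⁻¹' S ∩ {x | ∑ k, ℓ (x k) ≤ ε})
      ≤ Measure.pi (fun _ : Fin r => μ) S := by
    rw [pi_apply_eq_setLIntegral_exp_neg_sum μ hΨ hℓ hmap r hS, ← setLIntegral_const]
    refine (setLIntegral_mono' ((hΨr hS).inter hm) fun x hx => ?_).trans
      (lintegral_mono_set Set.inter_subset_left)
    exact ENNReal.ofReal_le_ofReal (Real.exp_le_exp.2 (neg_le_neg hx.2))
  have hgood' := mul_le_mul_right hgood (ENNReal.ofReal (Real.exp (- -ε)))
  rw [ofReal_exp_neg_mul_cancel, neg_neg] at hgood'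
  have hcover : (fun (x : Fin r → X) k => Ψ (x k)) ⁻¹' S
      ⊆ ((fun x k => Ψ (x k)) ⁻¹' S ∩ {x | ∑ k, ℓ (x k) ≤ ε}) ∪ {x | ε < ∑ k, ℓ (x k)} :=
    fun x hx => (le_or_gt (∑ k, ℓ (x k)) ε).imp (fun h => ⟨hx, h⟩) id
  exact (measure_mono hcover).trans ((measure_union_le _ _).trans
    (add_le_add hgood' (pi_lt_sum_le_exp μ hℓ ε hl hK r)))

lemma stdGaussianPi_eq_withDensity (n : ℕ) :
    stdGaussianPi (Fin n) = (volume : Measure (Fin n → ℝ)).withDensity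
      fun x => ∏ i, gaussianPDF 0 1 (x i) := by
  have : SigmaFinite ((volume : Measure ℝ).withDensity (gaussianPDF 0 1)) := by
    rw [← gaussianReal_of_var_ne_zero 0 one_ne_zero]; infer_instance
  rw [stdGaussianPi, gaussianReal_of_var_ne_zero 0 one_ne_zero,
    pi_withDensity _ n (measurable_gaussianPDF 0 1), volume_pi]

/-- The shear `y ↦ y - yᵢ u` transports the standard Gaussian, reweighted by the ratio of
densities, to the standard Gaussian. -/
lemma map_shear_withDensity {n : ℕ} (i : Fin n) (u : Fin n → ℝ) (hu : u i < 1) :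
    ((stdGaussianPi (Fin n)).withDensity fun y => ENNReal.ofReal (Real.exp (-(-Real.log (1 - u i)
      - y i * ∑ j, u j * y j + y i ^ 2 * (∑ j, u j ^ 2) / 2)))).map (fun y j => y j - y i * u j)
      = stdGaussianPi (Fin n) := by
  set Ψ : (Fin n → ℝ) → (Fin n → ℝ) := fun y j => y j - y i * u j with hΨ
  have hΨm : Measurable Ψ := by fun_prop
  set M : Matrix (Fin n) (Fin n) ℝ :=
    1 + replicateCol Unit (-u) * replicateRow Unit (Pi.single i (1 : ℝ)) with hM
  have hMΨ : ⇑(toLin' M) = Ψ := by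
    ext y j
    simp [hM, hΨ, Matrix.mulVec, dotProduct, Matrix.mul_apply, Pi.single_apply]
    ring
  have hdet : M.det = 1 - u i := by
    rw [hM, det_one_add_replicateCol_mul_replicateRow]; simp; ring
  have hpos : 0 < 1 - u i := by linarith
  have hvol := Real.map_matrix_volume_pi_eq_smul_volume_pi (M := M) (by rw [hdet]; exact hpos.ne')
  rw [hMΨ, hdet, abs_of_pos (inv_pos.2 hpos)] at hvol
  have hvol' : (volume : Measure (Fin n → ℝ))
      = ENNReal.ofReal (1 - u i) • (volume : Measure (Fin n → ℝ)).map Ψ := by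
    rw [hvol, smul_smul, ← ENNReal.ofReal_mul hpos.le, mul_inv_cancel₀ hpos.ne']; simp
  have hφ : Measurable fun x : Fin n → ℝ => ∏ i, gaussianPDF 0 1 (x i) := by
    have := measurable_gaussianPDF 0 1
    fun_prop
  rw [stdGaussianPi_eq_withDensity, ← withDensity_mul _ hφ (by fun_prop)]
  ext s hs
  rw [Measure.map_apply hΨm hs, withDensity_apply _ (hΨm hs), withDensity_apply _ hs]
  conv_rhs => rw [hvol', Measure.restrict_smul, lintegral_smul_measure,
    setLIntegral_map hs hφ hΨm, smul_eq_mul, ← lintegral_const_mul' _ _ ENNReal.ofReal_ne_top]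
  refine lintegral_congr fun y => ?_
  have hpdf : ∀ z : Fin n → ℝ, ∏ i, gaussianPDF 0 1 (z i)
      = ENNReal.ofReal ((√(2 * Real.pi))⁻¹ ^ n * Real.exp (-(∑ j, z j ^ 2) / 2)) := by
    intro z
    simp only [gaussianPDF, gaussianPDFReal]
    rw [← ENNReal.ofReal_prod_of_nonneg (fun _ _ => by positivity), Finset.prod_mul_distrib,
      ← Real.exp_sum]
    simp [← Finset.sum_div, Finset.sum_neg_distrib, neg_div]
  simp only [Pi.mul_apply]
  rw [hpdf, hpdf, ← ENNReal.ofReal_mul (by positivity), ← ENNReal.ofReal_mul hpos.le]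
  congr 1
  have hexp : Real.exp (-(-Real.log (1 - u i) - y i * ∑ j, u j * y j
        + y i ^ 2 * (∑ j, u j ^ 2) / 2))
      = (1 - u i) * Real.exp (y i * ∑ j, u j * y j - y i ^ 2 * (∑ j, u j ^ 2) / 2) := by
    rw [show -(-Real.log (1 - u i) - y i * ∑ j, u j * y j + y i ^ 2 * (∑ j, u j ^ 2) / 2)
      = Real.log (1 - u i) + (y i * ∑ j, u j * y j - y i ^ 2 * (∑ j, u j ^ 2) / 2) by ring,
      Real.exp_add, Real.exp_log hpos]
  have hsum : ∑ j, Ψ y j ^ 2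
      = ∑ j, y j ^ 2 - 2 * (y i * ∑ j, u j * y j) + y i ^ 2 * ∑ j, u j ^ 2 := by
    simp only [Finset.mul_sum, ← Finset.sum_sub_distrib, ← Finset.sum_add_distrib, hΨ]
    exact Finset.sum_congr rfl fun j _ => by ring
  have hmul : Real.exp (-(∑ j, Ψ y j ^ 2) / 2) = Real.exp (-(∑ j, y j ^ 2) / 2) *
      Real.exp (y i * ∑ j, u j * y j - y i ^ 2 * (∑ j, u j ^ 2) / 2) := by
    rw [hsum, ← Real.exp_add]; ring_nf
  rw [hexp, hmul]
  ring

lemma neg_log_one_sub_le {x : ℝ} (hx : |x| ≤ 1 / 2) : -Real.log (1 - x) ≤ x + 2 * x ^ 2 := by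
  have h := Real.abs_log_sub_add_sum_range_le (x := x) (by linarith) 1
  have h2 : |x| ^ 2 / (1 - |x|) ≤ 2 * x ^ 2 := by
    rw [div_le_iff₀ (by linarith), sq_abs]
    nlinarith [sq_nonneg x]
  have h3 := (neg_abs_le _).trans' (neg_le_neg h)
  norm_num at h3 h2
  linarith

lemma lintegral_exp_mul_gaussian (c : ℝ) :
    ∫⁻ x, ENNReal.ofReal (Real.exp (c * x)) ∂(gaussianReal 0 1)
      = ENNReal.ofReal (Real.exp (c ^ 2 / 2)) := by
  rw [← ofReal_integral_eq_lintegral_ofReal (integrable_exp_mul_gaussianReal c)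
    (.of_forall fun _ => (Real.exp_pos _).le)]
  have := mgf_gaussianReal (p := gaussianReal 0 1) (X := id) (μ := 0) (v := 1) (by simp) c
  rw [mgf] at this
  simp only [id] at this
  rw [this]; simp

lemma lintegral_exp_mul_sq_gaussian_le {k : ℝ} (hk : |k| ≤ 1 / 4) :
    ∫⁻ x, ENNReal.ofReal (Real.exp (k * x ^ 2)) ∂(gaussianReal 0 1)
      ≤ ENNReal.ofReal (Real.exp (k + 4 * k ^ 2)) := by
  have hk' := abs_le.1 hk
  have hb : 0 < 1 / 2 - k := by linarith
  have h1 : ∫⁻ x, ENNReal.ofReal (Real.exp (k * x ^ 2)) ∂(gaussianReal 0 1)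
      = ENNReal.ofReal ((√(2 * Real.pi))⁻¹ * √(Real.pi / (1 / 2 - k))) := by
    rw [gaussianReal_of_var_ne_zero 0 one_ne_zero,
      lintegral_withDensity_eq_lintegral_mul _ (measurable_gaussianPDF 0 1) (by fun_prop),
      ← integral_gaussian, ← integral_const_mul,
      ofReal_integral_eq_lintegral_ofReal ((integrable_exp_neg_mul_sq hb).const_mul _)
        (.of_forall fun _ => by positivity)]
    refine lintegral_congr fun x => ?_
    simp only [Pi.mul_apply, gaussianPDF, gaussianPDFReal]
    rw [← ENNReal.ofReal_mul (by positivity), mul_assoc, ← Real.exp_add]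
    congr 3
    · simp
    · simp; ring
  rw [h1]
  refine ENNReal.ofReal_le_ofReal ?_
  have h2 := neg_log_one_sub_le (x := 2 * k) (by rw [abs_mul]; norm_num; linarith)
  have h3 : (√(2 * Real.pi))⁻¹ * √(Real.pi / (1 / 2 - k)) = √((1 - 2 * k)⁻¹) := by
    rw [← Real.sqrt_inv, ← Real.sqrt_mul (by positivity)]
    congr 1
    have := Real.pi_pos.ne'
    have h4 : 1 - 2 * k ≠ 0 := by linarith
    have h5 : 1 / 2 - k ≠ 0 := hb.ne'
    have h6 : 1 - 2 * k = 2 * (1 / 2 - k) := by ring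
    rw [h6]
    field_simp
  rw [h3, Real.sqrt_le_left (Real.exp_pos _).le, ← Real.exp_nat_mul,
    ← Real.exp_log (x := (1 - 2 * k)⁻¹) (inv_pos.2 (by linarith)), Real.log_inv]
  refine Real.exp_le_exp.2 ?_
  push_cast
  linarith

/-- Exponential moment of the privacy loss of the shear `y ↦ y - yᵢ u`. -/
lemma lintegral_exp_shear_loss_le {n : ℕ} (i : Fin n) (u : Fin n → ℝ) {l k : ℝ}
    (hk : k = l * (-u i + (∑ j, u j ^ 2) / 2) + l ^ 2 * (∑ j, u j ^ 2 - u i ^ 2) / 2)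
    (hk4 : |k| ≤ 1 / 4) :
    ∫⁻ y, ENNReal.ofReal (Real.exp (l * (-Real.log (1 - u i) - y i * ∑ j, u j * y j
        + y i ^ 2 * (∑ j, u j ^ 2) / 2))) ∂(stdGaussianPi (Fin n))
      ≤ ENNReal.ofReal (Real.exp (-l * Real.log (1 - u i) + k + 4 * k ^ 2)) := by
  obtain _ | n := n
  · exact i.elim0
  set q := ∑ j, u j ^ 2 with hq
  have hq' : q = u i ^ 2 + ∑ j, u (i.succAbove j) ^ 2 := by rw [hq, Fin.sum_univ_succAbove _ i]
  rw [stdGaussianPi,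
    ← ((measurePreserving_piFinSuccAbove (fun _ : Fin (n + 1) => gaussianReal 0 1) i).symm).lintegral_comp
      (by fun_prop)]
  have hsplit : ∀ z : ℝ × (Fin n → ℝ),
      ENNReal.ofReal (Real.exp (l * (-Real.log (1 - u i)
        - (MeasurableEquiv.piFinSuccAbove (fun _ : Fin (n + 1) => ℝ) i).symm z i
          * ∑ j, u j * (MeasurableEquiv.piFinSuccAbove (fun _ : Fin (n + 1) => ℝ) i).symm z j
        + (MeasurableEquiv.piFinSuccAbove (fun _ : Fin (n + 1) => ℝ) i).symm z i ^ 2 * q / 2)))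
      = ENNReal.ofReal (Real.exp (-l * Real.log (1 - u i) + l * (-u i + q / 2) * z.1 ^ 2))
        * ∏ j, ENNReal.ofReal (Real.exp ((-l * z.1 * u (i.succAbove j)) * z.2 j)) := by
    rintro ⟨a, b⟩
    rw [← ENNReal.ofReal_prod_of_nonneg (fun _ _ => (Real.exp_pos _).le), ← Real.exp_sum,
      ← ENNReal.ofReal_mul (Real.exp_pos _).le, ← Real.exp_add]
    simp only [MeasurableEquiv.piFinSuccAbove, MeasurableEquiv.symm_mk,
      MeasurableEquiv.coe_mk, Fin.insertNthEquiv, Equiv.symm_symm, Equiv.coe_fn_mk,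
      Fin.insertNth_apply_same, Fin.sum_univ_succAbove _ i, Fin.insertNth_apply_succAbove]
    have : ∑ j, -l * a * u (i.succAbove j) * b j = -l * a * ∑ j, u (i.succAbove j) * b j := by
      rw [Finset.mul_sum]; exact Finset.sum_congr rfl fun j _ => by ring
    rw [this]
    ring_nf
  simp_rw [hsplit]
  rw [lintegral_prod _ (by fun_prop)]
  have hinner : ∀ a : ℝ,
      ∫⁻ b, ENNReal.ofReal (Real.exp (-l * Real.log (1 - u i) + l * (-u i + q / 2) * a ^ 2))
        * ∏ j, ENNReal.ofReal (Real.exp ((-l * a * u (i.succAbove j)) * b j))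
        ∂(Measure.pi fun _ : Fin n => gaussianReal 0 1)
      = ENNReal.ofReal (Real.exp (-l * Real.log (1 - u i)))
        * ENNReal.ofReal (Real.exp (k * a ^ 2)) := by
    intro a
    rw [lintegral_const_mul' _ _ ENNReal.ofReal_ne_top,
      lintegral_pi_prod _ n
        (fun j x => ENNReal.ofReal (Real.exp ((-l * a * u (i.succAbove j)) * x)))
        (fun j => by fun_prop)]
    simp_rw [lintegral_exp_mul_gaussian]
    rw [← ENNReal.ofReal_prod_of_nonneg (fun _ _ => (Real.exp_pos _).le), ← Real.exp_sum,
      ← ENNReal.ofReal_mul (Real.exp_pos _).le, ← ENNReal.ofReal_mul (Real.exp_pos _).le,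
      ← Real.exp_add, ← Real.exp_add]
    have : ∑ j, (-l * a * u (i.succAbove j)) ^ 2 / 2 = l ^ 2 * a ^ 2 * (q - u i ^ 2) / 2 := by
      rw [hq', add_sub_cancel_left, Finset.mul_sum, Finset.sum_div]
      exact Finset.sum_congr rfl fun j _ => by ring
    rw [this, hk]
    ring_nf
  simp_rw [hinner]
  rw [lintegral_const_mul' _ _ ENNReal.ofReal_ne_top]
  calc _ ≤ ENNReal.ofReal (Real.exp (-l * Real.log (1 - u i)))
        * ENNReal.ofReal (Real.exp (k + 4 * k ^ 2)) := by
        gcongr; exact lintegral_exp_mul_sq_gaussian_le hk4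
    _ = _ := by
        rw [← ENNReal.ofReal_mul (Real.exp_pos _).le, ← Real.exp_add, add_assoc]

lemma exists_vecMul_eq_of_le_mulVec {n d : ℕ} {A : Matrix (Fin n) (Fin d) ℝ} {w : ℝ} (hw : 0 < w)
    (hA : ∀ x : Fin d → ℝ, w * √(∑ j, x j ^ 2) ≤ √(∑ k, (A *ᵥ x) k ^ 2))
    {v : Fin d → ℝ} (hv : √(∑ j, v j ^ 2) ≤ 1) :
    ∃ u : Fin n → ℝ, u ᵥ* A = v ∧ w ^ 2 * ∑ j, u j ^ 2 ≤ 1 := by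
  have hdot : ∀ x y : Fin d → ℝ, x ⬝ᵥ ((Aᵀ * A) *ᵥ y) = (A *ᵥ x) ⬝ᵥ (A *ᵥ y) := by
    intro x y
    rw [← Matrix.mulVec_mulVec, Matrix.dotProduct_mulVec, Matrix.vecMul_transpose]
  have hself : ∀ {m : ℕ} (x : Fin m → ℝ), x ⬝ᵥ x = ∑ j, x j ^ 2 := fun x =>
    Finset.sum_congr rfl fun j _ => (sq _).symm
  have hinj : Function.Injective (toLin' (Aᵀ * A)) := by
    rw [← LinearMap.ker_eq_bot, LinearMap.ker_eq_bot']
    intro x hx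
    rw [toLin'_apply] at hx
    have h0 : ∑ k, (A *ᵥ x) k ^ 2 = 0 := by rw [← hself, ← hdot, hx, dotProduct_zero]
    have h1 := hA x
    rw [h0, Real.sqrt_zero] at h1
    have h2 : √(∑ j, x j ^ 2) ≤ 0 := by
      by_contra h; push Not at h; nlinarith [mul_pos hw h]
    have h3 : ∑ j, x j ^ 2 ≤ 0 := Real.sqrt_eq_zero'.1 (le_antisymm h2 (Real.sqrt_nonneg _))
    have h4 := (Finset.sum_eq_zero_iff_of_nonneg fun j _ => sq_nonneg (x j)).1
      (le_antisymm h3 (Finset.sum_nonneg fun j _ => sq_nonneg (x j)))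
    ext j
    exact pow_eq_zero_iff two_ne_zero |>.1 (h4 j (Finset.mem_univ j))
  obtain ⟨z, hz⟩ := LinearMap.surjective_of_injective hinj v
  rw [toLin'_apply] at hz
  refine ⟨A *ᵥ z, ?_, ?_⟩
  · rw [← hz, ← Matrix.mulVec_mulVec, Matrix.mulVec_transpose]
  · set N := √(∑ k, (A *ᵥ z) k ^ 2) with hN
    have hNsq : N ^ 2 = ∑ k, (A *ᵥ z) k ^ 2 :=
      Real.sq_sqrt (Finset.sum_nonneg fun _ _ => sq_nonneg _)
    have hN0 : 0 ≤ N := Real.sqrt_nonneg _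
    have h1 : N ^ 2 ≤ √(∑ j, z j ^ 2) * √(∑ j, v j ^ 2) := by
      rw [hNsq, ← hself, ← hdot, hz]
      exact Real.sum_mul_le_sqrt_mul_sqrt _ _ _
    have h2 : N ^ 2 ≤ √(∑ j, z j ^ 2) :=
      h1.trans (mul_le_of_le_one_right (Real.sqrt_nonneg _) hv)
    have h3 := hA z
    have h4 : w * N ≤ 1 := by
      by_contra h
      push Not at h
      have hNpos : 0 < N := by
        by_contra h0
        rw [le_antisymm (not_lt.1 h0) hN0] at h
        linarith
      nlinarith [mul_le_mul_of_nonneg_left h2 hw.le, mul_lt_mul_of_pos_right h hNpos]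
    rw [← hNsq, ← mul_pow]
    exact pow_le_one₀ (by positivity) h4

/-- Per-row bound on the log-moment of the shear privacy loss. -/
lemma shear_log_moment_le {p q t l k : ℝ} (ht0 : 0 < t) (ht2 : t ≤ 1 / 2) (hl0 : 0 < l)
    (hlt : l * t ≤ 1 / 16) (hpq : p ^ 2 ≤ q) (hqt : q ≤ t ^ 2)
    (hk : k = l * (-p + q / 2) + l ^ 2 * (q - p ^ 2) / 2) :
    |k| ≤ 1 / 4 ∧
      -l * Real.log (1 - p) + k + 4 * k ^ 2 ≤ 3 * (l * t ^ 2) + 9 * (l * t) ^ 2 := by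
  have hpt : |p| ≤ t := abs_le_of_sq_le_sq (hpq.trans hqt) ht0.le
  have hq0 : 0 ≤ q := (sq_nonneg p).trans hpq
  have hlt0 : 0 < l * t := mul_pos hl0 ht0
  have hlp : |l * p| ≤ l * t := by
    rw [abs_mul, abs_of_pos hl0]; exact mul_le_mul_of_nonneg_left hpt hl0.le
  have hlq : l * q ≤ l * t ^ 2 := mul_le_mul_of_nonneg_left hqt hl0.le
  have hlt2 : l * t ^ 2 ≤ l * t * (1 / 2) := by
    rw [sq, ← mul_assoc]; exact mul_le_mul_of_nonneg_left ht2 hlt0.le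
  have hl2 : l ^ 2 * (q - p ^ 2) ≤ (l * t) ^ 2 := by
    rw [mul_pow]
    exact mul_le_mul_of_nonneg_left (by linarith [sq_nonneg p]) (sq_nonneg l)
  have hlt4 : (l * t) ^ 2 ≤ l * t * (1 / 16) := by
    rw [sq]; exact mul_le_mul_of_nonneg_left hlt hlt0.le
  have h4 : 0 ≤ l ^ 2 * (q - p ^ 2) := mul_nonneg (sq_nonneg l) (by linarith)
  have h5 : 0 ≤ l * q := mul_nonneg hl0.le hq0
  have hkabs : |k| ≤ l * t * (21 / 16) := by
    obtain ⟨h6, h7⟩ := abs_le.1 hlp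
    rw [hk, abs_le]
    constructor <;> linarith
  refine ⟨by linarith, ?_⟩
  have hksq : k ^ 2 ≤ (l * t) ^ 2 * (441 / 256) := by
    have : k ^ 2 ≤ (l * t * (21 / 16)) ^ 2 :=
      sq_le_sq' (by linarith [(abs_le.1 hkabs).1]) (abs_le.1 hkabs).2
    linarith
  have h1 := mul_le_mul_of_nonneg_left (neg_log_one_sub_le (hpt.trans ht2)) hl0.le
  have h2 : l * p ^ 2 ≤ l * t ^ 2 := mul_le_mul_of_nonneg_left (hpq.trans hqt) hl0.le
  have h6 : 0 < l * t ^ 2 := by positivity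
  have h7 : 0 < (l * t) ^ 2 := by positivity
  have h8 : -l * Real.log (1 - p) + k
      ≤ l * (2 * p ^ 2) + l * q / 2 + l ^ 2 * (q - p ^ 2) / 2 := by
    rw [hk]; linarith
  linarith

/-- The Chernoff exponent of the shear privacy loss at parameter `l = log (2 / δ) / ε`. -/
lemma shear_chernoff_exponent_le {ε δ w p q : ℝ} {r : ℕ} (hε : 0 < ε ∧ ε < 1)
    (hδ : 0 < δ ∧ δ < 1) (hr : 0 < r)
    (hw : w = 16 * √(r * Real.log (2 / δ)) / ε * Real.log (16 * r / δ)) (hw2 : 2 ≤ w)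
    (hpq : p ^ 2 ≤ q) (hq : w ^ 2 * q ≤ 1) {l k : ℝ} (hl : l = Real.log (2 / δ) / ε)
    (hk : k = l * (-p + q / 2) + l ^ 2 * (q - p ^ 2) / 2) :
    |k| ≤ 1 / 4 ∧
      Real.exp (r * (-l * Real.log (1 - p) + k + 4 * k ^ 2) - l * ε) ≤ δ := by
  obtain ⟨hε0, hε1⟩ := hε
  obtain ⟨hδ0, hδ1⟩ := hδ
  have hr1 : (1 : ℝ) ≤ r := by exact_mod_cast hr
  set a := Real.log (2 / δ) with ha
  set m := Real.log (16 * r / δ) with hm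
  have ham : a ≤ m := by
    refine Real.log_le_log (by positivity) ?_
    gcongr
    linarith
  have hal : a = Real.log 2 - Real.log δ := Real.log_div two_ne_zero hδ0.ne'
  have hlogδ : Real.log δ < 0 := Real.log_neg hδ0 hδ1
  have hlog2 := Real.log_two_gt_d9
  have ha0 : 0 < a := by linarith
  have hm1 : 1 ≤ m := by
    rw [hm, Real.le_log_iff_exp_le (by positivity), le_div_iff₀ hδ0]
    nlinarith [Real.exp_one_lt_d9, Real.exp_pos 1]
  have hmm : m ≤ m ^ 2 := le_self_pow₀ hm1 two_ne_zero
  have hm2 : 0 < m ^ 2 := by linarith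
  have hl0 : 0 < l := by rw [hl]; positivity
  have hlε : l * ε = a := by rw [hl]; field_simp
  have hw0 : 0 < w := by linarith
  have hwε : w * ε = 16 * √(r * a) * m := by rw [hw]; field_simp
  have hw2' : w ^ 2 * ε ^ 2 = 256 * (r * a) * m ^ 2 := by
    rw [← mul_pow, hwε, mul_pow, mul_pow, Real.sq_sqrt (by positivity)]; ring
  set t := 1 / w with ht
  have ht0 : 0 < t := by positivity
  have hqt : q ≤ t ^ 2 := by
    rw [ht, div_pow, one_pow, le_div_iff₀ (by positivity)]; linarith
  have ht2 : t ≤ 1 / 2 := by rw [ht]; exact one_div_le_one_div_of_le two_pos hw2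
  have htw : t ^ 2 * w ^ 2 = 1 := by rw [ht]; field_simp
  have hrt : t ^ 2 * r * a * (256 * m ^ 2) = ε ^ 2 := by
    linear_combination -t ^ 2 * hw2' + ε ^ 2 * htw
  have hlt2 : 256 * (r * (l * t) ^ 2) ≤ 1 := by
    have h1 : r * (l * t) ^ 2 * (256 * m ^ 2) * ε ^ 2 = a * ε ^ 2 := by
      linear_combination a * hrt + t ^ 2 * r * 256 * m ^ 2 * (l * ε + a) * hlε
    have h2 : r * (l * t) ^ 2 * (256 * m ^ 2) = a := mul_right_cancel₀ (by positivity) h1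
    have h3 : 256 * (r * (l * t) ^ 2) * m ^ 2 ≤ 1 * m ^ 2 := by linarith
    exact le_of_mul_le_mul_right h3 hm2
  have hrlt : 256 * (r * (l * t ^ 2)) ≤ 1 := by
    have h1 : r * (l * t ^ 2) * (256 * m ^ 2) * ε = ε * ε := by
      linear_combination hrt + t ^ 2 * r * 256 * m ^ 2 * hlε
    have h2 : r * (l * t ^ 2) * (256 * m ^ 2) = ε := mul_right_cancel₀ hε0.ne' h1
    have h3 : 256 * (r * (l * t ^ 2)) * m ^ 2 ≤ 1 * m ^ 2 := by linarith
    exact le_of_mul_le_mul_right h3 hm2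
  have hlt : l * t ≤ 1 / 16 := by
    have : (l * t) ^ 2 ≤ (1 / 16) ^ 2 := by
      linarith [mul_le_mul_of_nonneg_right hr1 (sq_nonneg (l * t))]
    exact (sq_le_sq₀ (by positivity) (by norm_num)).1 this
  obtain ⟨hk4, hmain⟩ := shear_log_moment_le ht0 ht2 hl0 hlt hpq hqt hk
  refine ⟨hk4, ?_⟩
  rw [← Real.le_log_iff_exp_le hδ0, hlε]
  have hfin := mul_le_mul_of_nonneg_left hmain (by linarith : (0 : ℝ) ≤ r)
  linarith

/-- Corollary: privacy of a random Gaussian projection of a well-conditioned matrix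
(all singular values of `A` and `A'` at least `w`). -/
theorem random_projection_privacy {n d : ℕ} (hn : 0 < n) (hd : 0 < d) {ε δ : ℝ}
    (hε : 0 < ε ∧ ε < 1) (hδ : 0 < δ ∧ δ < 1) {r : ℕ} (hr : 0 < r) {w : ℝ}
    (hw : w = 16 * Real.sqrt (r * Real.log (2 / δ)) / ε * Real.log (16 * r / δ))
    (hw2 : 2 ≤ w)
    {A A' : Matrix (Fin n) (Fin d) ℝ} (hnb : MatNeighbors A A')
    (hAsv : ∀ x : Fin d → ℝ,
      w * Real.sqrt (∑ j, x j ^ 2) ≤ Real.sqrt (∑ k, (A *ᵥ x) k ^ 2))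
    (hA'sv : ∀ x : Fin d → ℝ,
      w * Real.sqrt (∑ j, x j ^ 2) ≤ Real.sqrt (∑ k, (A' *ᵥ x) k ^ 2))
    {S : Set (Matrix (Fin r) (Fin d) ℝ)} (hS : MeasurableSet S) :
    Measure.map (fun M : Matrix (Fin r) (Fin n) ℝ => M * A)
        (stdGaussianMatrix (Fin r) (Fin n)) S
    ≤ ENNReal.ofReal (Real.exp ε) *
        Measure.map (fun M : Matrix (Fin r) (Fin n) ℝ => M * A')
          (stdGaussianMatrix (Fin r) (Fin n)) S
      + ENNReal.ofReal δ := by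
  obtain ⟨i, v, hv, hA'⟩ := hnb
  obtain ⟨u, hu, hwu⟩ := exists_vecMul_eq_of_le_mulVec (by linarith) hA'sv hv
  have hpq : u i ^ 2 ≤ ∑ j, u j ^ 2 :=
    Finset.single_le_sum (f := fun j => u j ^ 2) (fun j _ => sq_nonneg (u j)) (Finset.mem_univ i)
  have hui : u i < 1 := by
    nlinarith [sq_nonneg (u i - 1), mul_le_mul_of_nonneg_right
      (pow_le_pow_left₀ two_pos.le hw2 2) ((sq_nonneg (u i)).trans hpq)]
  have hmeas : ∀ B : Matrix (Fin n) (Fin d) ℝ,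
      Measurable fun M : Matrix (Fin r) (Fin n) ℝ => M * B := by
    intro B
    refine measurable_pi_iff.2 fun k => measurable_pi_iff.2 fun j => ?_
    simp only [Matrix.mul_apply]
    exact Finset.measurable_sum _ fun c _ =>
      ((measurable_pi_apply c).comp (measurable_pi_apply k)).mul_const _
  have hpre : (fun M : Matrix (Fin r) (Fin n) ℝ => M * A) ⁻¹' S
      = (fun (M : Fin r → Fin n → ℝ) k j => M k j - M k i * u j) ⁻¹'
        ((fun M : Matrix (Fin r) (Fin n) ℝ => M * A') ⁻¹' S) := by
    ext M
    have : M * A = (Matrix.of fun k j => M k j - M k i * u j) * A' := by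
      ext k c
      have huc : ∑ j, u j * A' j c = v c := congrFun hu c
      have h1 : ∑ j, M k j * A' j c = ∑ j, M k j * A j c + M k i * v c := by
        simp [hA', mul_add, Finset.sum_add_distrib]
      simp only [Matrix.mul_apply, Matrix.of_apply, sub_mul, Finset.sum_sub_distrib, mul_assoc,
        ← Finset.mul_sum, huc, h1]
      ring
    simp only [Set.mem_preimage]
    rw [this]
    rfl
  obtain ⟨hk4, hexp⟩ := shear_chernoff_exponent_le hε hδ hr hw hw2 hpq hwu rfl rfl
  have hl : 0 ≤ Real.log (2 / δ) / ε :=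
    div_nonneg (Real.log_nonneg (by rw [le_div_iff₀ hδ.1]; linarith [hδ.2])) hε.1.le
  have key := pi_preimage_le_of_exp_moment (stdGaussianPi (Fin n)) (ε := ε) (by fun_prop)
    (by fun_prop) (map_shear_withDensity i u hui) hl (lintegral_exp_shear_loss_le i u rfl hk4) r
    (hmeas A' hS)
  rw [Measure.map_apply (hmeas A) hS, Measure.map_apply (hmeas A') hS, hpre]
  exact key.trans (add_le_add le_rfl (ENNReal.ofReal_le_ofReal hexp))
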